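/- Let T : M → A be a Rota–Baxter operator on an anti-flexible algebra (A,·) with respect to a bimodule (M,l,r). Define m ⋆_T n = l(T(m))n + r(T(n))m on M, and define l_T, r_T : M → End(A) by l_T(m)(a) = T(m)·a − T(r(a)m) and r_T(m)(a) = a·T(m) − T(l(a)m). Then (M, ⋆_T) is an anti-flexible algebra and (A, l_T, r_T) is a bimodule over (M, ⋆_T), i.e. l_T(m ⋆_T n) − l_T(m)∘l_T(n) = r_T(m)∘r_T(n) − r_T(n ⋆_T m) and l_T(m)∘r_T(n) − r_T(n)∘l_T(m) = l_T(n)∘r_T(m) − r_T(m)∘l_T(n) for all m, n ∈ M. -/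

import Mathlib

/-- The anti-flexible identity for a (bilinear) product. -/
def AntiFlexible {A : Type*} [AddCommGroup A] (mul : A → A → A) : Prop :=
  ∀ a b c : A, mul (mul a b) c - mul a (mul b c) = mul (mul c b) a - mul c (mul b a)

/-- The bimodule equations for `(M, l, r)` over `(A, mul)`. -/
def IsBimodule {K A M : Type*} [Field K] [AddCommGroup A] [Module K A]
    [AddCommGroup M] [Module K M]
    (mul : A →ₗ[K] A →ₗ[K] A) (l r : A →ₗ[K] Module.End K M) : Prop :=
  (∀ a b : A, l (mul a b) - l a * l b = r a * r b - r (mul b a)) ∧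
  (∀ a b : A, l a * r b - r b * l a = l b * r a - r a * l b)

/-- Rota–Baxter operator `T : M → A`. -/
def IsRotaBaxter {K A M : Type*} [Field K] [AddCommGroup A] [Module K A]
    [AddCommGroup M] [Module K M]
    (mul : A →ₗ[K] A →ₗ[K] A) (l r : A →ₗ[K] Module.End K M) (T : M →ₗ[K] A) : Prop :=
  ∀ m n : M, mul (T m) (T n) = T (l (T m) n + r (T n) m)

/-- The product `m ⋆_T n = l(T m)n + r(T n)m` on `M` induced by `T`. -/
def starT {K A M : Type*} [Field K] [AddCommGroup A] [Module K A]
    [AddCommGroup M] [Module K M]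
    (l r : A →ₗ[K] Module.End K M) (T : M →ₗ[K] A) : M → M → M :=
  fun m n => l (T m) n + r (T n) m

/-- `l_T(m)(a) = T(m)·a − T(r(a)m)`. -/
def lT {K A M : Type*} [Field K] [AddCommGroup A] [Module K A]
    [AddCommGroup M] [Module K M]
    (mul : A →ₗ[K] A →ₗ[K] A) (r : A →ₗ[K] Module.End K M) (T : M →ₗ[K] A) :
    M → A → A :=
  fun m a => mul (T m) a - T (r a m)

/-- `r_T(m)(a) = a·T(m) − T(l(a)m)`. -/
def rT {K A M : Type*} [Field K] [AddCommGroup A] [Module K A]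
    [AddCommGroup M] [Module K M]
    (mul : A →ₗ[K] A →ₗ[K] A) (l : A →ₗ[K] Module.End K M) (T : M →ₗ[K] A) :
    M → A → A :=
  fun m a => mul a (T m) - T (l a m)

theorem IsRotaBaxter.lT_lT {K A M : Type*} [Field K] [AddCommGroup A] [Module K A]
    [AddCommGroup M] [Module K M] {mul : A →ₗ[K] A →ₗ[K] A} {l r : A →ₗ[K] Module.End K M}
    {T : M →ₗ[K] A} (hT : IsRotaBaxter mul l r T) (m n : M) (a : A) :
    lT mul r T m (lT mul r T n a)
      = mul (T m) (mul (T n) a) - T (l (T m) (r a n)) - T (r (mul (T n) a) m) := by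
  simp only [lT, map_sub, LinearMap.sub_apply, hT _ _, map_add]
  abel

theorem IsRotaBaxter.rT_rT {K A M : Type*} [Field K] [AddCommGroup A] [Module K A]
    [AddCommGroup M] [Module K M] {mul : A →ₗ[K] A →ₗ[K] A} {l r : A →ₗ[K] Module.End K M}
    {T : M →ₗ[K] A} (hT : IsRotaBaxter mul l r T) (m n : M) (a : A) :
    rT mul l T m (rT mul l T n a)
      = mul (mul a (T n)) (T m) - T (r (T m) (l a n)) - T (l (mul a (T n)) m) := by
  simp only [rT, map_sub, LinearMap.sub_apply, hT _ _, map_add]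
  abel

theorem IsRotaBaxter.lT_rT {K A M : Type*} [Field K] [AddCommGroup A] [Module K A]
    [AddCommGroup M] [Module K M] {mul : A →ₗ[K] A →ₗ[K] A} {l r : A →ₗ[K] Module.End K M}
    {T : M →ₗ[K] A} (hT : IsRotaBaxter mul l r T) (m n : M) (a : A) :
    lT mul r T m (rT mul l T n a)
      = mul (T m) (mul a (T n)) - T (l (T m) (l a n)) - T (r (mul a (T n)) m) := by
  simp only [lT, rT, map_sub, LinearMap.sub_apply, hT _ _, map_add]
  abel

theorem IsRotaBaxter.rT_lT {K A M : Type*} [Field K] [AddCommGroup A] [Module K A]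
    [AddCommGroup M] [Module K M] {mul : A →ₗ[K] A →ₗ[K] A} {l r : A →ₗ[K] Module.End K M}
    {T : M →ₗ[K] A} (hT : IsRotaBaxter mul l r T) (m n : M) (a : A) :
    rT mul l T n (lT mul r T m a)
      = mul (mul (T m) a) (T n) - T (r (T n) (r a m)) - T (l (mul (T m) a) n) := by
  simp only [lT, rT, map_sub, LinearMap.sub_apply, hT _ _, map_add]
  abel

/-- `(M, ⋆_T)` is an anti-flexible algebra and `(A, l_T, r_T)` is a bimodule
over it. -/
theorem rotaBaxter_induced_bimodule {K A M : Type*} [Field K]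
    [AddCommGroup A] [Module K A] [AddCommGroup M] [Module K M]
    (mul : A →ₗ[K] A →ₗ[K] A) (hA : AntiFlexible fun a b => mul a b)
    (l r : A →ₗ[K] Module.End K M) (hbim : IsBimodule mul l r)
    (T : M →ₗ[K] A) (hT : IsRotaBaxter mul l r T) :
    AntiFlexible (starT l r T) ∧
    (∀ (m n : M) (a : A),
      lT mul r T (starT l r T m n) a - lT mul r T m (lT mul r T n a)
        = rT mul l T m (rT mul l T n a) - rT mul l T (starT l r T n m) a) ∧
    (∀ (m n : M) (a : A),
      lT mul r T m (rT mul l T n a) - rT mul l T n (lT mul r T m a)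
        = lT mul r T n (rT mul l T m a) - rT mul l T m (lT mul r T n a)) := by
  have h₁ (a b : A) (x : M) : l (mul a b) x - l a (l b x) = r a (r b x) - r (mul b a) x :=
    LinearMap.congr_fun (hbim.1 a b) x
  have h₂ (a b : A) (x : M) : l a (r b x) - r b (l a x) = l b (r a x) - r a (l b x) :=
    LinearMap.congr_fun (hbim.2 a b) x
  have hA' (a b c : A) :
      mul (mul a b) c - mul a (mul b c) = mul (mul c b) a - mul c (mul b a) := hA a b c
  have hT' (m n : M) : T (l (T m) n) + T (r (T n) m) = mul (T m) (T n) := by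
    rw [← map_add, hT m n]
  refine ⟨fun x y z => ?_, fun m n a => ?_, fun m n a => ?_⟩
  · simp only [starT, map_add, hT']
    linear_combination (norm := abel) h₁ (T x) (T y) z - h₂ (T x) (T z) y - h₁ (T z) (T y) x
  · rw [hT.lT_lT, hT.rT_rT]
    simp only [lT, rT, starT, map_add, hT']
    have e₁ := congrArg T (h₁ a (T n) m)
    have e₂ := congrArg T (h₂ (T m) a n)
    simp only [map_sub] at e₁ e₂
    linear_combination (norm := abel) hA' (T m) (T n) a + e₁ + e₂
  · rw [hT.lT_rT, hT.rT_lT, hT.lT_rT, hT.rT_lT]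
    have e₁ := congrArg T (h₁ (T m) a n)
    have e₂ := congrArg T (h₁ (T n) a m)
    simp only [map_sub] at e₁ e₂
    linear_combination (norm := abel) e₁ - e₂ - hA' (T m) a (T n)
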